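/- arXiv:2502.01009 — 6 statements merged into one kernel-verified Lean document; each statement's English description precedes it below -/
import Mathlib

section
/- Let t0 be a real number, let b : ℝ → ℝ be differentiable on [t0, ∞), and let α : ℝ → ℝ be a continuous, strictly increasing function with α(0) = 0 (an extended class K function). If b(t0) ≥ 0 and for all t ≥ t0 the derivative satisfies b'(t) ≥ -α(b(t)), then b(t) ≥ 0 for all t ≥ t0 (forward invariance of the set {b ≥ 0} under the control-barrier-function condition). -/
/-- Forward invariance of the safe set `{b ≥ 0}` under the control-barrier-function
condition `b'(t) ≥ -α(b(t))`, where `α` is an extended class K function. -/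
theorem cbf_forward_invariance
    (t0 : ℝ) (b b' : ℝ → ℝ) (α : ℝ → ℝ)
    (hb : ∀ t ∈ Set.Ici t0, HasDerivAt b (b' t) t)
    (hα_cont : Continuous α) (hα_mono : StrictMono α) (hα0 : α 0 = 0)
    (hinit : 0 ≤ b t0)
    (hcbf : ∀ t ≥ t0, b' t ≥ -α (b t)) :
    ∀ t ≥ t0, 0 ≤ b t := by
  intro t ht
  refine le_of_forall_pos_le_add fun ε hε => ?_
  have hsub : ∀ x ∈ Set.Ico t0 t, HasDerivWithinAt (fun s => -b s) (-b' x) (Set.Ici x) x :=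
    fun x hx => (hb x hx.1).neg.hasDerivWithinAt
  have hcont : ContinuousOn (fun s => -b s) (Set.Icc t0 t) :=
    fun x hx => (hb x hx.1).neg.continuousAt.continuousWithinAt
  have hle : -b t ≤ ε := by
    refine image_le_of_deriv_right_lt_deriv_boundary (B := fun _ => ε) (B' := fun _ => 0)
      hcont hsub (by linarith) (fun x => hasDerivAt_const x ε) (fun x hx hxε => ?_)
      (Set.right_mem_Icc.2 ht)
    have hneg : α (b x) < 0 := hα0 ▸ hα_mono (by linarith)
    linarith [hcbf x hx.1]
  linarith
end

section
/- Let t0 be a real number, let b : ℝ → ℝ be differentiable on [t0, ∞), and let α : ℝ → ℝ be a continuous, strictly increasing function with α(0) = 0 (an extended class K function). If b'(t) ≥ -α(b(t)) for all t ≥ t0, then b(t) ≥ min(b(t0), 0) for all t ≥ t0. -/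
/-- Robustness of the control-barrier-function condition: if `b'(t) ≥ -α(b(t))` for an
extended class K function `α`, then the barrier value never drops below `min (b t0) 0`. -/
theorem cbf_lower_bound
    (t0 : ℝ) (b b' : ℝ → ℝ) (α : ℝ → ℝ)
    (hb : ∀ t ∈ Set.Ici t0, HasDerivAt b (b' t) t)
    (hα_cont : Continuous α) (hα_mono : StrictMono α) (hα0 : α 0 = 0)
    (hcbf : ∀ t ≥ t0, b' t ≥ -α (b t)) :
    ∀ t ≥ t0, b t ≥ min (b t0) 0 := by
  intro t ht
  by_contra! hlt
  obtain ⟨m, hbm, hm⟩ := exists_between hlt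
  obtain ⟨hmb, hm0⟩ := lt_min_iff.mp hm
  have hαm : α m < 0 := hα0 ▸ hα_mono hm0
  have key := image_le_of_deriv_right_lt_deriv_boundary (f := fun x => -b x)
    (f' := fun x => -b' x) (a := t0) (b := t) (B := fun _ => -m) (B' := fun _ => 0)
    (fun x hx => (hb x hx.1).neg.continuousAt.continuousWithinAt)
    (fun x hx => (hb x hx.1).neg.hasDerivWithinAt)
    (neg_le_neg hmb.le) (fun x => hasDerivAt_const x _)
    (fun x hx hxm => by
      have hx' := hcbf x hx.1
      rw [neg_injective hxm] at hx'
      linarith)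
    (Set.right_mem_Icc.mpr ht)
  exact (neg_le_neg_iff.mp key).not_gt hbm
end

section
/- Let t0 be a real number, let b : ℝ → ℝ be differentiable on [t0, ∞), and let α : ℝ → ℝ be a continuous, strictly increasing function with α(0) = 0 (an extended class K function). If b'(t) ≥ -α(b(t)) for all t ≥ t0, then for every ε > 0 there exists T ≥ t0 such that b(t) ≥ -ε for all t ≥ T. In particular, even if b(t0) < 0, the trajectory is asymptotically stabilized toward the set {b ≥ 0}. -/
/-- Stabilization property of the control Lyapunov-barrier condition: if
`b'(t) ≥ -α(b(t))` for an extended class K function `α`, then the trajectory is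
asymptotically driven toward the safe set `{b ≥ 0}`. -/
theorem clbf_asymptotic_stabilization
    (t0 : ℝ) (b b' : ℝ → ℝ) (α : ℝ → ℝ)
    (hb : ∀ t ∈ Set.Ici t0, HasDerivAt b (b' t) t)
    (hα_cont : Continuous α) (hα_mono : StrictMono α) (hα0 : α 0 = 0)
    (hcbf : ∀ t ≥ t0, b' t ≥ -α (b t)) :
    ∀ ε > 0, ∃ T ≥ t0, ∀ t ≥ T, b t ≥ -ε := by
  intro ε hε
  have hα_neg : α (-ε) < 0 := hα0 ▸ hα_mono (neg_lt_zero.mpr hε)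
  obtain ⟨T, hT, hbT⟩ : ∃ T ≥ t0, -ε ≤ b T := by
    by_contra! hlt
    have hb0 : b t0 < -ε := hlt t0 le_rfl
    set d := (-ε - b t0) / -α (-ε)
    have hd_pos : 0 < d := div_pos (by linarith) (by linarith)
    have hd_mul : -α (-ε) * d = -ε - b t0 := mul_div_cancel₀ _ (by linarith)
    obtain ⟨s, hs, hslope⟩ := exists_hasDerivAt_eq_slope b b' (lt_add_of_pos_right t0 hd_pos)
      (fun x hx => (hb x hx.1).continuousAt.continuousWithinAt)
      (fun x hx => hb x hx.1.le)
    have hderiv : -α (-ε) ≤ b' s := by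
      linarith [hcbf s hs.1.le, hα_mono (hlt s hs.1.le)]
    rw [hslope, add_sub_cancel_left, le_div_iff₀ hd_pos, hd_mul] at hderiv
    linarith [hlt (t0 + d) (by linarith)]
  refine ⟨T, hT, fun t ht => ?_⟩
  have hbound : -b t ≤ ε :=
    image_le_of_deriv_right_lt_deriv_boundary (f := fun x => -b x) (f' := fun x => -b' x)
      (B := fun _ => ε) (B' := fun _ => 0) (a := T) (b := t)
      (fun x hx => (hb x (hT.trans hx.1)).neg.continuousAt.continuousWithinAt)
      (fun x hx => (hb x (hT.trans hx.1)).neg.hasDerivWithinAt)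
      (by linarith) (fun x => hasDerivAt_const x ε)
      (fun x hx hxε => by
        have hbx : b x = -ε := by linarith
        have hcx := hcbf x (hT.trans hx.1)
        rw [hbx] at hcx
        linarith)
      ⟨ht, le_rfl⟩
  linarith
end

section
/- Let t0 be a real number, let b : ℝ → ℝ be twice differentiable on [t0, ∞), and let α1, α2 : ℝ → ℝ be continuous, strictly increasing functions with α1(0) = α2(0) = 0 (extended class K functions), with α1 differentiable. Define ψ1(t) = b'(t) + α1(b(t)). If b(t0) ≥ 0, ψ1(t0) ≥ 0, and ψ1'(t) ≥ -α2(ψ1(t)) for all t ≥ t0, then ψ1(t) ≥ 0 and b(t) ≥ 0 for all t ≥ t0 (forward invariance of the intersection of the zero-superlevel sets C1 ∩ C2 under the second-order HOCBF condition). -/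
/-- A function `f` with `f' ≥ -α(f)` for an extended class K function `α` stays nonnegative
once it starts nonnegative. -/
theorem nonneg_of_hasDerivAt_ge_neg_strictMono {t0 : ℝ} {f f' α : ℝ → ℝ}
    (hf : ∀ t ∈ Set.Ici t0, HasDerivAt f (f' t) t)
    (hα_mono : StrictMono α) (hα_zero : α 0 = 0) (hinit : 0 ≤ f t0)
    (hbound : ∀ t ≥ t0, -α (f t) ≤ f' t) :
    ∀ t ≥ t0, 0 ≤ f t := by
  intro t ht
  refine le_of_forall_pos_le_add fun ε hε ↦ ?_
  have h : -f t ≤ ε := by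
    refine image_le_of_deriv_right_lt_deriv_boundary (f := fun x ↦ -f x) (f' := fun x ↦ -f' x)
      (B := fun _ ↦ ε) (B' := fun _ ↦ 0) (a := t0) (b := t)
      (fun x hx ↦ (hf x hx.1).continuousAt.neg.continuousWithinAt)
      (fun x hx ↦ (hf x hx.1).neg.hasDerivWithinAt) (by linarith)
      (fun x ↦ hasDerivAt_const x ε) (fun x hx hfx ↦ ?_) ⟨ht, le_rfl⟩
    have hneg : α (f x) < α 0 := hα_mono (by linarith)
    linarith [hbound x hx.1]
  linarith


/-- Forward invariance of `C1 ∩ C2` under the second-order HOCBF condition: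
with `ψ1 = b' + α1 ∘ b` (so that `ψ1' = b'' + α1'(b)·b'`), if `b(t0) ≥ 0`, `ψ1(t0) ≥ 0`
and `ψ1'(t) ≥ -α2(ψ1(t))` for all `t ≥ t0`, then `ψ1(t) ≥ 0` and `b(t) ≥ 0` for all
`t ≥ t0`. -/
theorem hocbf_order_two_forward_invariance
    (t0 : ℝ) (b b' b'' : ℝ → ℝ) (α1 α2 : ℝ → ℝ)
    (hb : ∀ t ∈ Set.Ici t0, HasDerivAt b (b' t) t)
    (hb' : ∀ t ∈ Set.Ici t0, HasDerivAt b' (b'' t) t)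
    (hα1_cont : Continuous α1) (hα1_mono : StrictMono α1) (hα1_zero : α1 0 = 0)
    (hα1_diff : Differentiable ℝ α1)
    (hα2_cont : Continuous α2) (hα2_mono : StrictMono α2) (hα2_zero : α2 0 = 0)
    (hinit_b : 0 ≤ b t0)
    (hinit_ψ1 : 0 ≤ b' t0 + α1 (b t0))
    (hhocbf : ∀ t ≥ t0,
      b'' t + deriv α1 (b t) * b' t ≥ -α2 (b' t + α1 (b t))) :
    ∀ t ≥ t0, 0 ≤ b' t + α1 (b t) ∧ 0 ≤ b t := by
  have hψ : ∀ t ≥ t0, 0 ≤ b' t + α1 (b t) :=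
    nonneg_of_hasDerivAt_ge_neg_strictMono (f := fun t ↦ b' t + α1 (b t))
      (fun t ht ↦ (hb' t ht).add ((hα1_diff (b t)).hasDerivAt.comp t (hb t ht)))
      hα2_mono hα2_zero hinit_ψ1 hhocbf
  have hb_nonneg := nonneg_of_hasDerivAt_ge_neg_strictMono hb hα1_mono hα1_zero hinit_b
    fun t ht ↦ by linarith [hψ t ht]
  exact fun t ht ↦ ⟨hψ t ht, hb_nonneg t ht⟩
end

section
/- Let t0 be a real number, γ1, γ2 > 0, μ a natural number, and let b : ℝ → ℝ be twice differentiable on [t0, ∞). If b(t0) ≥ 0, b'(t0) + γ1·b(t0)^(2μ+1) ≥ 0, and for all t ≥ t0 it holds that b''(t) + (2μ+1)·γ1·b(t)^(2μ)·b'(t) + γ2·(b'(t) + γ1·b(t)^(2μ+1))^(2μ+1) ≥ 0, then b(t) ≥ 0 for all t ≥ t0. -/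
/-- A function satisfying `y' + γ y ^ n ≥ 0` with `γ > 0` and `n` odd, and starting from a
nonnegative value, stays nonnegative. -/
theorem nonneg_of_deriv_add_mul_odd_pow_nonneg {t0 γ : ℝ} (hγ : 0 < γ) {n : ℕ} (hn : Odd n)
    {y y' : ℝ → ℝ} (hy : ∀ t ∈ Set.Ici t0, HasDerivAt y (y' t) t) (h0 : 0 ≤ y t0)
    (h : ∀ t ≥ t0, 0 ≤ y' t + γ * y t ^ n) : ∀ t ≥ t0, 0 ≤ y t := by
  intro t ht
  refine le_of_forall_pos_le_add fun ε hε => ?_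
  have key : -y t ≤ ε := by
    refine image_le_of_deriv_right_lt_deriv_boundary (f := fun s => -y s) (f' := fun s => -y' s)
      (B := fun _ => ε) (B' := fun _ => 0) (a := t0) (b := t)
      (fun s hs => (hy s hs.1).neg.continuousAt.continuousWithinAt)
      (fun s hs => (hy s hs.1).neg.hasDerivWithinAt) (by linarith)
      (fun s => hasDerivAt_const s ε) (fun s hs hsε => ?_) ⟨ht, le_rfl⟩
    have hneg : y s < 0 := by linarith
    have hpow : γ * y s ^ n < 0 := mul_neg_of_pos_of_neg hγ (hn.pow_neg hneg)
    linarith [h s hs.1]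
  linarith

/-- Forward-invariance half of the paper's Theorem 1 along a scalar trajectory, with
the odd-power class K choices `α1(s) = γ1·s^(2μ+1)` and `α2(s) = γ2·s^(2μ+1)`. -/
theorem hocbf_odd_power_forward_invariance
    (t0 : ℝ) (γ1 γ2 : ℝ) (hγ1 : 0 < γ1) (hγ2 : 0 < γ2) (μ : ℕ)
    (b b' b'' : ℝ → ℝ)
    (hb : ∀ t ∈ Set.Ici t0, HasDerivAt b (b' t) t)
    (hb' : ∀ t ∈ Set.Ici t0, HasDerivAt b' (b'' t) t)
    (hinit_b : 0 ≤ b t0)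
    (hinit_ψ1 : 0 ≤ b' t0 + γ1 * (b t0) ^ (2 * μ + 1))
    (hhocbf : ∀ t ≥ t0,
      b'' t + (2 * μ + 1 : ℝ) * γ1 * (b t) ^ (2 * μ) * b' t
        + γ2 * (b' t + γ1 * (b t) ^ (2 * μ + 1)) ^ (2 * μ + 1) ≥ 0) :
    ∀ t ≥ t0, 0 ≤ b t := by
  have hψ : ∀ t ≥ t0, 0 ≤ b' t + γ1 * b t ^ (2 * μ + 1) := by
    refine nonneg_of_deriv_add_mul_odd_pow_nonneg hγ2 (odd_two_mul_add_one μ)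
      (fun t ht => (hb' t ht).add (((hb t ht).pow (2 * μ + 1)).const_mul γ1)) hinit_ψ1
      fun t ht => ?_
    refine (hhocbf t ht).le.trans_eq ?_
    simp only [Nat.add_sub_cancel]
    push_cast
    ring
  exact nonneg_of_deriv_add_mul_odd_pow_nonneg hγ1 (odd_two_mul_add_one μ) hb hinit_b hψ
end

section
/- Let t0 be a real number, γ1, γ2 > 0, μ a natural number, and let b : ℝ → ℝ be twice differentiable on [t0, ∞). If for all t ≥ t0 it holds that b''(t) + (2μ+1)·γ1·b(t)^(2μ)·b'(t) + γ2·(b'(t) + γ1·b(t)^(2μ+1))^(2μ+1) ≥ 0, then for every ε > 0 there exists T ≥ t0 such that b(t) ≥ -ε for all t ≥ T; that is, even when initialized with b(t0) < 0 the trajectory is asymptotically stabilized toward the set {b ≥ 0}. -/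
/-- A function whose derivative is at least `c > 0` whenever its value is at most `-ε` is
eventually at least `-ε`. -/
theorem eventually_ge_neg_of_deriv_ge {f f' : ℝ → ℝ} {t₀ ε c : ℝ} (hc : 0 < c)
    (hf : ∀ t ≥ t₀, HasDerivAt f (f' t) t) (h : ∀ t ≥ t₀, f t ≤ -ε → c ≤ f' t) :
    ∃ T ≥ t₀, ∀ t ≥ T, f t ≥ -ε := by
  obtain ⟨T, hT, hfT⟩ : ∃ T ≥ t₀, -ε ≤ f T := by
    by_contra! hlt
    have key : ∀ t ≥ t₀, -f t ≤ -f t₀ - c / 2 * (t - t₀) := fun t ht ↦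
      image_le_of_deriv_right_lt_deriv_boundary (f := fun s ↦ -f s) (f' := fun s ↦ -f' s)
        (B := fun s ↦ -f t₀ - c / 2 * (s - t₀)) (B' := fun _ ↦ -(c / 2)) (a := t₀) (b := t)
        (fun s hs ↦ (hf s hs.1).neg.continuousAt.continuousWithinAt)
        (fun s hs ↦ (hf s hs.1).neg.hasDerivWithinAt) (by simp)
        (fun s ↦ by
          simpa using (((hasDerivAt_id s).sub_const t₀).const_mul (c / 2)).const_sub (-f t₀))
        (fun s hs _ ↦ by linarith [h s hs.1 (hlt s hs.1).le]) ⟨ht, le_rfl⟩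
    have hs : t₀ ≤ t₀ + 2 * (-ε - f t₀) / c := by
      have := hlt t₀ le_rfl
      have : 0 ≤ 2 * (-ε - f t₀) / c := div_nonneg (by linarith) hc.le
      linarith
    have h1 := key _ hs
    have h2 := hlt _ hs
    have h3 : c / 2 * (t₀ + 2 * (-ε - f t₀) / c - t₀) = -ε - f t₀ := by
      field_simp
      ring
    linarith
  refine ⟨T, hT, fun t ht ↦ ?_⟩
  have := image_le_of_deriv_right_lt_deriv_boundary (f := fun s ↦ -f s) (f' := fun s ↦ -f' s)
    (B := fun _ ↦ ε) (B' := fun _ ↦ 0) (a := T) (b := t)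
    (fun s hs ↦ (hf s (hT.trans hs.1)).neg.continuousAt.continuousWithinAt)
    (fun s hs ↦ (hf s (hT.trans hs.1)).neg.hasDerivWithinAt) (by linarith)
    (fun s ↦ hasDerivAt_const s ε)
    (fun s hs hfs ↦ by linarith [h s (hT.trans hs.1) (by linarith)]) ⟨ht, le_rfl⟩
  linarith

/-- If `f' + γ f ^ n ≥ -δ` with `n` odd and `δ < γ ε ^ n`, then `f` is eventually at least `-ε`. -/
theorem eventually_ge_neg_of_deriv_add_odd_pow_ge {f f' : ℝ → ℝ} {t₀ γ ε δ : ℝ} {n : ℕ}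
    (hn : Odd n) (hγ : 0 < γ) (hδ : δ < γ * ε ^ n)
    (hf : ∀ t ≥ t₀, HasDerivAt f (f' t) t) (h : ∀ t ≥ t₀, -δ ≤ f' t + γ * f t ^ n) :
    ∃ T ≥ t₀, ∀ t ≥ T, f t ≥ -ε := by
  refine eventually_ge_neg_of_deriv_ge (sub_pos.2 hδ) hf fun t ht hft ↦ ?_
  have hpow : f t ^ n ≤ -ε ^ n := hn.neg_pow ε ▸ hn.strictMono_pow.monotone hft
  linarith [h t ht, mul_le_mul_of_nonneg_left hpow hγ.le]

/-- Stabilization half of the paper's Theorem 1 along a scalar trajectory, with the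
odd-power class K choices `α1(s) = γ1·s^(2μ+1)` and `α2(s) = γ2·s^(2μ+1)`: even when
initialized with `b(t0) < 0`, the trajectory is asymptotically stabilized toward the
safe set `{b ≥ 0}`. -/
theorem hocbf_odd_power_stabilization
    (t0 : ℝ) (γ1 γ2 : ℝ) (hγ1 : 0 < γ1) (hγ2 : 0 < γ2) (μ : ℕ)
    (b b' b'' : ℝ → ℝ)
    (hb : ∀ t ∈ Set.Ici t0, HasDerivAt b (b' t) t)
    (hb' : ∀ t ∈ Set.Ici t0, HasDerivAt b' (b'' t) t)
    (hhocbf : ∀ t ≥ t0,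
      b'' t + (2 * μ + 1 : ℝ) * γ1 * (b t) ^ (2 * μ) * b' t
        + γ2 * (b' t + γ1 * (b t) ^ (2 * μ + 1)) ^ (2 * μ + 1) ≥ 0) :
    ∀ ε > 0, ∃ T ≥ t0, ∀ t ≥ T, b t ≥ -ε := by
  intro ε hε
  have hodd : Odd (2 * μ + 1) := odd_two_mul_add_one μ
  obtain ⟨T, hT, hψ⟩ := eventually_ge_neg_of_deriv_add_odd_pow_ge
    (f := fun t ↦ b' t + γ1 * b t ^ (2 * μ + 1))
    (f' := fun t ↦ b'' t + (2 * μ + 1 : ℝ) * γ1 * b t ^ (2 * μ) * b' t)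
    (ε := γ1 * ε ^ (2 * μ + 1) / 2) (δ := 0) hodd hγ2 (by positivity)
    (fun t ht ↦ by
      refine ((hb' t ht).add (((hb t ht).pow (2 * μ + 1)).const_mul γ1)).congr_deriv ?_
      push_cast
      ring)
    (fun t ht ↦ by simpa using hhocbf t ht)
  obtain ⟨S, hS, hbS⟩ := eventually_ge_neg_of_deriv_add_odd_pow_ge hodd hγ1
    (half_lt_self (by positivity)) (fun t ht ↦ hb t (hT.trans ht)) hψ
  exact ⟨S, hT.trans hS, hbS⟩
end
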